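/- Let (X,M,*) be a fuzzy metric space in which every bounded real-valued continuous function on (X,τ_M) is R-uniformly continuous. Then every subset of X that is closed and discrete in (X,τ_M) is fuzzy uniformly discrete in (X,M,*). -/

import Mathlib

open Filter Topology Set

/-- A fuzzy metric space in the sense of George and Veeramani: a continuous
t-norm `star` on `[0,1]` together with a fuzzy set `M` on `X × X × (0,∞)`. -/
structure FuzzyMetric (X : Type*) where
  M : X → X → ℝ → ℝ
  star : ℝ → ℝ → ℝ
  star_mem : ∀ a ∈ Set.Icc (0:ℝ) 1, ∀ b ∈ Set.Icc (0:ℝ) 1, star a b ∈ Set.Icc (0:ℝ) 1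
  star_comm : ∀ a ∈ Set.Icc (0:ℝ) 1, ∀ b ∈ Set.Icc (0:ℝ) 1, star a b = star b a
  star_assoc : ∀ a ∈ Set.Icc (0:ℝ) 1, ∀ b ∈ Set.Icc (0:ℝ) 1, ∀ c ∈ Set.Icc (0:ℝ) 1,
    star (star a b) c = star a (star b c)
  star_one : ∀ a ∈ Set.Icc (0:ℝ) 1, star a 1 = a
  star_mono : ∀ a b c d : ℝ, a ∈ Set.Icc (0:ℝ) 1 → b ∈ Set.Icc (0:ℝ) 1 →
    c ∈ Set.Icc (0:ℝ) 1 → d ∈ Set.Icc (0:ℝ) 1 → a ≤ b → c ≤ d → star a c ≤ star b d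
  star_continuous : ContinuousOn (fun p : ℝ × ℝ => star p.1 p.2)
    (Set.Icc (0:ℝ) 1 ×ˢ Set.Icc (0:ℝ) 1)
  M_pos : ∀ x y t, 0 < t → 0 < M x y t
  M_le_one : ∀ x y t, 0 < t → M x y t ≤ 1
  M_eq_one_iff : ∀ x y t, 0 < t → (M x y t = 1 ↔ x = y)
  M_symm : ∀ x y t, 0 < t → M x y t = M y x t
  M_triangle : ∀ x y z t s, 0 < t → 0 < s → star (M x y t) (M y z s) ≤ M x z (t + s)
  M_continuousOn : ∀ x y, ContinuousOn (M x y) (Set.Ioi (0:ℝ))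

namespace FuzzyMetric

variable {X : Type*}

/-- The open ball `B(x,r,t)`. -/
def ball (F : FuzzyMetric X) (x : X) (r t : ℝ) : Set X := {y | 1 - r < F.M x y t}

/-- The topology `τ_M` induced by the fuzzy metric (the balls form a base for it). -/
def topology (F : FuzzyMetric X) : TopologicalSpace X :=
  TopologicalSpace.generateFrom
    {s | ∃ x : X, ∃ r t : ℝ, r ∈ Set.Ioo (0:ℝ) 1 ∧ 0 < t ∧ s = F.ball x r t}

/-- `f : X → ℝ` is `ℝ`-uniformly continuous. -/
def RUniformlyContinuous (F : FuzzyMetric X) (f : X → ℝ) : Prop :=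
  ∀ ε > (0:ℝ), ∃ r ∈ Set.Ioo (0:ℝ) 1, ∃ s > (0:ℝ),
    ∀ x y : X, 1 - r < F.M x y s → |f x - f y| < ε

/-- The Lebesgue property: every open cover is refined by the family of balls of
some fixed radius `r` and parameter `t`. -/
def Lebesgue (F : FuzzyMetric X) : Prop :=
  ∀ 𝒢 : Set (Set X), (∀ G ∈ 𝒢, F.topology.IsOpen G) → ⋃₀ 𝒢 = Set.univ →
    ∃ r ∈ Set.Ioo (0:ℝ) 1, ∃ t > (0:ℝ), ∀ x : X, ∃ G ∈ 𝒢, F.ball x r t ⊆ G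

/-- A set `A ⊆ X` is fuzzy uniformly discrete. -/
def UniformlyDiscrete (F : FuzzyMetric X) (A : Set X) : Prop :=
  ∃ r ∈ Set.Ioo (0:ℝ) 1, ∃ s > (0:ℝ), ∀ x ∈ A, ∀ y ∈ A, x ≠ y → F.M x y s < 1 - r

/-- The set `X'` of accumulation points of `(X, τ_M)`. -/
def derivedSet (F : FuzzyMetric X) : Set X :=
  {x | ∀ U : Set X, F.topology.IsOpen U → x ∈ U → ∃ y ∈ U, y ≠ x}

/-- A sequence is Cauchy in the fuzzy metric. -/
def IsCauchy (F : FuzzyMetric X) (u : ℕ → X) : Prop :=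
  ∀ ε ∈ Set.Ioo (0:ℝ) 1, ∀ t > (0:ℝ), ∃ k : ℕ, ∀ m ≥ k, ∀ n ≥ k, 1 - ε < F.M (u m) (u n) t

/-- Sequential compactness: every sequence has a convergent subsequence. -/
def SeqCompact (F : FuzzyMetric X) : Prop :=
  ∀ u : ℕ → X, ∃ x : X, ∃ φ : ℕ → ℕ, StrictMono φ ∧
    Filter.Tendsto (u ∘ φ) Filter.atTop (@nhds X F.topology x)

end FuzzyMetric

open scoped Uniformity

/-- In a uniform space with countably generated uniformity on which every bounded continuous
real function is uniformly continuous, closed discrete subsets are uniformly discrete. -/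
theorem IsClosed.exists_entourage_of_discreteTopology {X : Type*} [UniformSpace X]
    [(𝓤 X).IsCountablyGenerated]
    (h : ∀ f : X → ℝ, Continuous f → (∃ C : ℝ, ∀ x, |f x| ≤ C) → UniformContinuous f)
    {A : Set X} (hA : IsClosed A) [DiscreteTopology A] :
    ∃ V ∈ 𝓤 X, ∀ x ∈ A, ∀ y ∈ A, (x, y) ∈ V → x = y := by
  by_contra! hcon
  obtain ⟨V, hV, hsymm⟩ := UniformSpace.has_seq_basis X
  have hiso : ∀ a ∈ A, ∀ᶠ n in atTop, ∀ b ∈ A, (a, b) ∈ V n → b = a := by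
    intro a ha
    obtain ⟨U, hU, hUA⟩ := discreteTopology_subtype_iff'.1 ‹DiscreteTopology A› a ha
    have haU : a ∈ U := (hUA.ge rfl).1
    obtain ⟨W, hW, hWU⟩ := UniformSpace.mem_nhds_iff.1 (hU.mem_nhds haU)
    filter_upwards [hV.eventually_subset hW] with n hn b hb hab
    have hbU : b ∈ U ∩ A := ⟨hWU (hn hab), hb⟩
    rwa [hUA] at hbU
  obtain ⟨u, hu, hlt⟩ := exists_seq_of_forall_finset_exists
    (fun p : ℕ × X × X => p.2.1 ∈ A ∧ p.2.2 ∈ A ∧ (p.2.1, p.2.2) ∈ V p.1 ∧ p.2.1 ≠ p.2.2)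
    (fun p q => p.1 < q.1 ∧ p.2.1 ≠ q.2.2 ∧ p.2.2 ≠ q.2.1) (by
      intro s hs
      have hev : ∀ᶠ n in atTop, ∀ p ∈ s, p.1 < n ∧
          (∀ b ∈ A, (p.2.1, b) ∈ V n → b = p.2.1) ∧ (∀ b ∈ A, (p.2.2, b) ∈ V n → b = p.2.2) :=
        (Finset.eventually_all s).2 fun p hp =>
          (eventually_gt_atTop p.1).and ((hiso _ (hs p hp).1).and (hiso _ (hs p hp).2.1))
      obtain ⟨n, hn⟩ := hev.exists
      obtain ⟨x, hx, y, hy, hxy, hne⟩ := hcon (V n) (hV.mem n)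
      have hyx : (y, x) ∈ V n := (hsymm n).symm _ _ hxy
      refine ⟨(n, x, y), ⟨hx, hy, hxy, hne⟩, fun p hp => ⟨(hn p hp).1, ?_, ?_⟩⟩
      · intro hpy
        exact hne (((hn p hp).2.1 x hx (by rwa [hpy])).trans hpy)
      · intro hpx
        exact hne (((hn p hp).2.2 y hy (by rwa [hpx])).trans hpx).symm)
  have hmono : StrictMono fun n => (u n).1 := fun m n hmn => (hlt m n hmn).1
  have hsub : ∀ S ⊆ A, IsClosed S := by
    intro S hS
    have := hA.isClosedEmbedding_subtypeVal.isClosedMap _ (isClosed_discrete ((↑) ⁻¹' S : Set A))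
    rwa [Subtype.image_preimage_coe, inter_eq_right.2 hS] at this
  set S : Set X := range fun n => (u n).2.1
  have hSA : S ⊆ A := range_subset_iff.2 fun n => (hu n).1
  have hyS : ∀ n, (u n).2.2 ∈ A \ S := by
    refine fun n => ⟨(hu n).2.1, ?_⟩
    rintro ⟨m, hm⟩
    rcases lt_trichotomy m n with hmn | rfl | hmn
    · exact (hlt m n hmn).2.1 hm
    · exact (hu m).2.2.2 hm
    · exact (hlt n m hmn).2.2 hm.symm
  obtain ⟨f, hf0, hf1, hf⟩ := exists_continuous_zero_one_of_isClosed (hsub S hSA)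
    (hsub (A \ S) sdiff_subset) disjoint_sdiff_right
  have huc := h f f.continuous ⟨1, fun x => abs_le.2 ⟨by linarith [(hf x).1], (hf x).2⟩⟩
  obtain ⟨n, hn⟩ := (hV.eventually_subset (huc (Metric.dist_mem_uniformity one_pos))).exists
  have hmem := hn (hV.antitone (hmono.id_le n) (hu n).2.2.1)
  have h0 : f (u n).2.1 = 0 := hf0 ⟨n, rfl⟩
  have h1 : f (u n).2.2 = 1 := hf1 (hyS n)
  simp [h0, h1] at hmem

namespace FuzzyMetric

variable {X : Type*} (F : FuzzyMetric X)

theorem M_self (x : X) {t : ℝ} (ht : 0 < t) : F.M x x t = 1 :=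
  (F.M_eq_one_iff x x t ht).2 rfl

theorem M_mem_Icc (x y : X) {t : ℝ} (ht : 0 < t) : F.M x y t ∈ Icc (0 : ℝ) 1 :=
  ⟨(F.M_pos x y t ht).le, F.M_le_one x y t ht⟩

theorem M_mono (x y : X) {s t : ℝ} (hs : 0 < s) (hst : s ≤ t) : F.M x y s ≤ F.M x y t := by
  rcases hst.eq_or_lt with rfl | hlt
  · rfl
  · have := F.M_triangle x y y s (t - s) hs (sub_pos.2 hlt)
    rwa [F.M_self y (sub_pos.2 hlt), F.star_one _ (F.M_mem_Icc x y hs), add_sub_cancel] at this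

theorem exists_lt_star {a c : ℝ} (ha : a ∈ Icc (0 : ℝ) 1) (hc : c < a) :
    ∃ δ ∈ Ioo (0 : ℝ) 1, c < F.star a (1 - δ) := by
  have hcont : ContinuousWithinAt (F.star a) (Icc 0 1) 1 :=
    (F.star_continuous (a, 1) ⟨ha, by simp⟩).comp (f := fun b => (a, b))
      (by fun_prop) (fun b hb => ⟨ha, hb⟩)
  have hev : ∀ᶠ b in 𝓝[Icc 0 1] (1 : ℝ), c < F.star a b :=
    hcont.eventually_const_lt (by rwa [F.star_one a ha])
  have hlim : Tendsto (fun δ : ℝ => 1 - δ) (𝓝[>] 0) (𝓝[Icc 0 1] 1) := by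
    refine tendsto_nhdsWithin_iff.2 ⟨?_, ?_⟩
    · exact ((continuous_const.sub continuous_id).tendsto' 0 1 (by simp)).mono_left
        nhdsWithin_le_nhds
    · filter_upwards [Ioo_mem_nhdsGT one_pos] with δ hδ
      exact ⟨by linarith [hδ.2], by linarith [hδ.1]⟩
  obtain ⟨δ, h1, h2⟩ := ((hlim.eventually hev).and (Ioo_mem_nhdsGT one_pos)).exists
  exact ⟨δ, h2, h1⟩

/-- The entourage of pairs that are `e`-close at parameter `e`. -/
def entourage (e : ℝ) : Set (X × X) := {p | 1 - e < F.M p.1 p.2 e}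

theorem entourage_mono {d e : ℝ} (hd : 0 < d) (hde : d ≤ e) : F.entourage d ⊆ F.entourage e :=
  fun p (hp : 1 - d < F.M p.1 p.2 d) =>
    (by linarith [F.M_mono p.1 p.2 hd hde] : 1 - e < F.M p.1 p.2 e)

theorem exists_entourage_subset {r s : ℝ} (hr : 0 < r) (hs : 0 < s) :
    ∃ e ∈ Ioo (0 : ℝ) 1, F.entourage e ⊆ {p | 1 - r < F.M p.1 p.2 s} := by
  obtain ⟨e, he, her⟩ := exists_between (lt_min (lt_min hr hs) one_pos)
  simp only [lt_min_iff] at her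
  refine ⟨e, ⟨he, her.2⟩, fun p (hp : 1 - e < F.M p.1 p.2 e) => ?_⟩
  have := F.M_mono p.1 p.2 he her.1.2.le
  exact (by linarith [her.1.1] : 1 - r < F.M p.1 p.2 s)

theorem exists_entourage_comp_subset {e : ℝ} (he : e ∈ Ioo (0 : ℝ) 1) :
    ∃ d ∈ Ioo (0 : ℝ) 1, ∀ x y z, (x, y) ∈ F.entourage d → (y, z) ∈ F.entourage d →
      (x, z) ∈ F.entourage e := by
  have ha : 1 - e / 2 ∈ Icc (0 : ℝ) 1 := ⟨by linarith [he.2], by linarith [he.1]⟩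
  obtain ⟨δ, hδ, hstar⟩ := F.exists_lt_star ha (c := 1 - e) (by linarith [he.1])
  have he2 : 0 < e / 2 := half_pos he.1
  obtain ⟨d, hd, hsub⟩ := F.exists_entourage_subset (lt_min he2 hδ.1) he2
  refine ⟨d, hd, fun x y z hxy hyz => ?_⟩
  have h1 : 1 - min (e / 2) δ < F.M x y (e / 2) := hsub hxy
  have h2 : 1 - min (e / 2) δ < F.M y z (e / 2) := hsub hyz
  have htri := F.M_triangle x y z _ _ he2 he2
  rw [add_halves] at htri
  have hmono := F.star_mono _ _ _ _ ha (F.M_mem_Icc x y he2)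
    (⟨by linarith [hδ.2], by linarith [hδ.1]⟩ : 1 - δ ∈ Icc (0 : ℝ) 1) (F.M_mem_Icc y z he2)
    (by linarith [min_le_left (e / 2) δ]) (by linarith [min_le_right (e / 2) δ])
  exact hstar.trans_le (hmono.trans htri)

/-- The sets `F.entourage e`, `0 < e < 1`, as a filter basis. -/
def entourageBasis : FilterBasis (X × X) where
  sets := F.entourage '' Ioo 0 1
  nonempty := ⟨_, 1 / 2, by norm_num, rfl⟩
  inter_sets := by
    rintro _ _ ⟨d, hd, rfl⟩ ⟨e, he, rfl⟩
    have hm : 0 < min d e := lt_min hd.1 he.1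
    exact ⟨_, ⟨min d e, ⟨hm, min_lt_of_left_lt hd.2⟩, rfl⟩, subset_inter
      (F.entourage_mono hm (min_le_left _ _)) (F.entourage_mono hm (min_le_right _ _))⟩

/-- The core of the uniform structure induced by a fuzzy metric. -/
def uniformCore : UniformSpace.Core X :=
  .mkOfBasis F.entourageBasis
    (by
      rintro _ ⟨e, he, rfl⟩ x
      exact (by rw [F.M_self x he.1]; linarith [he.1] : 1 - e < F.M x x e))
    (by
      rintro _ ⟨e, he, rfl⟩
      refine ⟨_, ⟨e, he, rfl⟩, fun p (hp : 1 - e < F.M p.1 p.2 e) => ?_⟩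
      exact (by rwa [F.M_symm _ _ _ he.1] : 1 - e < F.M p.2 p.1 e))
    (by
      rintro _ ⟨e, he, rfl⟩
      obtain ⟨d, hd, hsub⟩ := F.exists_entourage_comp_subset he
      refine ⟨_, ⟨d, hd, rfl⟩, ?_⟩
      rintro ⟨x, z⟩ ⟨y, hxy, hyz⟩
      exact hsub x y z hxy hyz)

theorem hasBasis_uniformCore :
    F.uniformCore.uniformity.HasBasis (fun e : ℝ => e ∈ Ioo (0 : ℝ) 1) F.entourage :=
  ⟨fun s => by
    rw [show F.uniformCore.uniformity = F.entourageBasis.filter from rfl,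
      F.entourageBasis.mem_filter_iff]
    exact exists_mem_image⟩

theorem exists_entourage_subset_ball {x y : X} {r t : ℝ} (ht : 0 < t)
    (hy : y ∈ F.ball x r t) : ∃ e ∈ Ioo (0 : ℝ) 1, ∀ z, (y, z) ∈ F.entourage e →
      z ∈ F.ball x r t := by
  have hev : ∀ᶠ s in 𝓝 t, 1 - r < F.M x y s :=
    ((F.M_continuousOn x y).continuousAt (Ioi_mem_nhds ht)).eventually_const_lt hy
  obtain ⟨s, hs, hs0, hst⟩ := ((hev.filter_mono nhdsWithin_le_nhds).and
    (Ioo_mem_nhdsLT ht)).exists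
  obtain ⟨δ, hδ, hstar⟩ := F.exists_lt_star (F.M_mem_Icc x y hs0) hs
  obtain ⟨e, he, hsub⟩ := F.exists_entourage_subset hδ.1 (sub_pos.2 hst)
  refine ⟨e, he, fun z hz => ?_⟩
  have hz' : 1 - δ < F.M y z (t - s) := hsub hz
  have htri := F.M_triangle x y z s (t - s) hs0 (sub_pos.2 hst)
  rw [add_sub_cancel] at htri
  have hmono := F.star_mono _ _ _ _ (F.M_mem_Icc x y hs0) (F.M_mem_Icc x y hs0)
    (⟨by linarith [hδ.2], by linarith [hδ.1]⟩ : 1 - δ ∈ Icc (0 : ℝ) 1)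
    (F.M_mem_Icc y z (sub_pos.2 hst)) le_rfl hz'.le
  exact hstar.trans_le (hmono.trans htri)

theorem topology_eq : F.topology = F.uniformCore.toTopologicalSpace := by
  have hb (x : X) := (F.uniformCore.nhds_toTopologicalSpace x) ▸
    F.hasBasis_uniformCore.comap (Prod.mk x)
  apply le_antisymm
  · intro U hU
    refine (@isOpen_iff_mem_nhds X F.topology U).2 fun x hx => ?_
    obtain ⟨e, he, hsub⟩ := (hb x).mem_iff.1
      ((@isOpen_iff_mem_nhds X F.uniformCore.toTopologicalSpace U).1 hU x hx)
    refine mem_of_superset (@IsOpen.mem_nhds X F.topology x (F.ball x e e)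
      (TopologicalSpace.isOpen_generateFrom_of_mem ⟨x, e, e, he, he.1, rfl⟩) ?_) hsub
    exact (by rw [F.M_self x he.1]; linarith [he.1] : 1 - e < F.M x x e)
  · refine le_generateFrom ?_
    rintro _ ⟨x, r, t, -, ht, rfl⟩
    refine (@isOpen_iff_mem_nhds X F.uniformCore.toTopologicalSpace _).2 fun y hy => ?_
    obtain ⟨e, he, hsub⟩ := F.exists_entourage_subset_ball ht hy
    exact (hb y).mem_iff.2 ⟨e, he, hsub⟩

/-- The uniform structure induced by a fuzzy metric, with topology `F.topology`. -/
abbrev uniformSpace : UniformSpace X := .ofCoreEq F.uniformCore F.topology F.topology_eq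

theorem hasBasis_uniformity :
    (𝓤[F.uniformSpace]).HasBasis (fun e : ℝ => e ∈ Ioo (0 : ℝ) 1) F.entourage :=
  F.hasBasis_uniformCore

theorem isCountablyGenerated_uniformity : (𝓤[F.uniformSpace]).IsCountablyGenerated := by
  refine HasCountableBasis.isCountablyGenerated (p := fun _ : ℕ => True)
    (s := fun n => F.entourage (1 / ((n : ℝ) + 1 + 1)))
    ⟨F.hasBasis_uniformity.to_hasBasis (fun e he => ?_) (fun n _ => ?_), to_countable _⟩
  · obtain ⟨n, hn⟩ := exists_nat_one_div_lt he.1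
    refine ⟨n, trivial, F.entourage_mono (by positivity) (le_trans ?_ hn.le)⟩
    gcongr
    linarith
  · refine ⟨_, ⟨by positivity, ?_⟩, Subset.rfl⟩
    rw [div_lt_one (by positivity)]
    linarith [(Nat.cast_nonneg n : (0 : ℝ) ≤ n)]

theorem RUniformlyContinuous.uniformContinuous {F : FuzzyMetric X} {f : X → ℝ}
    (hf : F.RUniformlyContinuous f) : @UniformContinuous X ℝ F.uniformSpace _ f := by
  refine (F.hasBasis_uniformity.tendsto_iff Metric.uniformity_basis_dist).2 fun ε hε => ?_
  obtain ⟨r, hr, s, hs, hrs⟩ := hf ε hε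
  obtain ⟨e, he, hsub⟩ := F.exists_entourage_subset hr.1 hs
  exact ⟨e, he, fun p hp => hrs p.1 p.2 (hsub hp)⟩

end FuzzyMetric

/-- If every bounded real-valued continuous function on `(X, τ_M)` is `ℝ`-uniformly
continuous, then every closed and discrete subset of `(X, τ_M)` is fuzzy uniformly
discrete in `(X,M,*)`. -/
theorem closed_discrete_uniformlyDiscrete {X : Type*} [Nonempty X] (F : FuzzyMetric X)
    (h : ∀ f : X → ℝ, @Continuous X ℝ F.topology _ f → (∃ C : ℝ, ∀ x : X, |f x| ≤ C) →
      F.RUniformlyContinuous f) :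
    ∀ A : Set X, @IsClosed X F.topology A →
      (∀ a ∈ A, ∃ U : Set X, F.topology.IsOpen U ∧ U ∩ A = {a}) →
      F.UniformlyDiscrete A := by
  let _ := F.uniformSpace
  have := F.isCountablyGenerated_uniformity
  intro A hA hdisc
  have : DiscreteTopology A := discreteTopology_subtype_iff'.2 hdisc
  obtain ⟨V, hV, hVA⟩ := hA.exists_entourage_of_discreteTopology
    fun f hf hbdd => (h f hf hbdd).uniformContinuous
  obtain ⟨e, he, hsub⟩ := F.hasBasis_uniformity.mem_iff.1 hV
  refine ⟨e / 2, ⟨half_pos he.1, by linarith [he.2]⟩, e, he.1, fun x hx y hy hne => ?_⟩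
  by_contra! hle
  exact hne (hVA x hx y hy (hsub (by linarith [he.1] : 1 - e < F.M x y e)))
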